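/- Let b ∈ ℝ with b ≠ 0, and let S_ℂ denote the set of smooth 2π-periodic functions ℝ → ℂ; write e_n(x) = exp(inx). Suppose A : (ℝ → ℂ) → (ℝ → ℂ) is a ℂ-linear map with A e_0 = e_0 and A e_n = (2(1 + n²)/b)·e_n for every nonzero integer n, sending S_ℂ into S_ℂ, and suppose that for every u ∈ S_ℂ there exists w ∈ S_ℂ with A w = 2·(Au)·u' + u·(Au)' and w − w'' = b·(u − u'')·u' + u·(u − u'')'. Then b = 2 (and consequently A e_n = (1 + n²)·e_n for all n, i.e. A = 1 − ∂ₓ² on S_ℂ). -/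

import Mathlib

/-- The set of smooth `2π`-periodic functions `ℝ → ℂ`, identified with `C^∞(S¹, ℂ)`. -/
def SmoothPeriodicC : Set (ℝ → ℂ) :=
  {f | ContDiff ℝ (⊤ : ℕ∞) f ∧ Function.Periodic f (2 * Real.pi)}

/-- The exponential `e_n(x) = exp(inx)`. -/
noncomputable def expC (n : ℤ) : ℝ → ℂ := fun x => Complex.exp (Complex.I * n * x)

theorem hasDerivAt_expC (n : ℤ) (x : ℝ) :
    HasDerivAt (expC n) (Complex.I * n * expC n x) x := by
  have h : HasDerivAt (fun y : ℝ => Complex.I * n * (y : ℂ)) (Complex.I * n * 1) x :=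
    (HasDerivAt.ofReal_comp (hasDerivAt_id x)).const_mul _
  exact h.cexp.congr_deriv (by rw [expC]; ring)

theorem deriv_expC (n : ℤ) : deriv (expC n) = fun x => Complex.I * n * expC n x :=
  funext fun x => (hasDerivAt_expC n x).deriv

theorem expC_mem_smoothPeriodicC (n : ℤ) : expC n ∈ SmoothPeriodicC := by
  refine ⟨?_, fun x => ?_⟩
  · unfold expC
    exact (contDiff_const.mul Complex.ofRealCLM.contDiff).cexp
  · unfold expC
    rw [Complex.exp_eq_exp_iff_exists_int]
    exact ⟨n, by push_cast; ring⟩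

/-- A periodic solution of `f' = a f` with `a` real and nonzero vanishes. -/
theorem Function.Periodic.eq_zero_of_hasDerivAt_mul {f : ℝ → ℂ} {a T : ℝ}
    (hf : Function.Periodic f T) (hT : T ≠ 0) (ha : a ≠ 0)
    (hd : ∀ x, HasDerivAt f (a * f x) x) : f = 0 := by
  have hexp (x : ℝ) :
      HasDerivAt (fun y : ℝ => Complex.exp (-a * y)) (-a * Complex.exp (-a * x)) x := by
    have h : HasDerivAt (fun y : ℝ => -(a : ℂ) * (y : ℂ)) (-a * 1) x :=
      (HasDerivAt.ofReal_comp (hasDerivAt_id x)).const_mul _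
    exact h.cexp.congr_deriv (by ring)
  have hg (x : ℝ) : HasDerivAt (fun y : ℝ => f y * Complex.exp (-a * y)) 0 x := by
    exact ((hd x).mul (hexp x)).congr_deriv (by ring)
  funext x
  have h := is_const_of_deriv_eq_zero (fun y => (hg y).differentiableAt)
    (fun y => (hg y).deriv) (x + T) x
  simp only [hf x] at h
  by_contra hx
  have hre := Real.exp_injective (by
    simpa only [Complex.norm_exp] using congrArg norm (mul_left_cancel₀ hx h))
  simp [ha, hT] at hre

/-- The operator `1 - ∂ₓ²` is injective on smooth periodic functions. -/
theorem eq_zero_of_sub_deriv_deriv_eq_zero {h : ℝ → ℂ} (hh : h ∈ SmoothPeriodicC)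
    (hL : ∀ x, h x - deriv (deriv h) x = 0) : h = 0 := by
  obtain ⟨hs, hp⟩ := hh
  have hT : 2 * Real.pi ≠ 0 := Real.two_pi_pos.ne'
  have hd (x : ℝ) : HasDerivAt h (deriv h x) x :=
    (hs.differentiable (by simp) x).hasDerivAt
  have hs' : ContDiff ℝ (⊤ : ℕ∞) (deriv h) := (contDiff_infty_iff_deriv.mp hs).2
  have hdd (x : ℝ) : HasDerivAt (deriv h) (h x) x := by
    rw [sub_eq_zero.mp (hL x)]
    exact (hs'.differentiable (by simp) x).hasDerivAt
  have hp' : Function.Periodic (deriv h) (2 * Real.pi) := fun x => by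
    rw [← deriv_comp_add_const, funext hp]
  have hsum : h + deriv h = 0 :=
    (hp.add hp').eq_zero_of_hasDerivAt_mul hT one_ne_zero fun x =>
      ((hd x).add (hdd x)).congr_deriv (by simp [add_comm])
  refine hp.eq_zero_of_hasDerivAt_mul (a := -1) hT (by norm_num) fun x => ?_
  refine (hd x).congr_deriv ?_
  have := congrFun hsum x
  simp only [Pi.add_apply, Pi.zero_apply] at this
  push_cast
  linear_combination this

theorem sub_mem_smoothPeriodicC {f g : ℝ → ℂ} (hf : f ∈ SmoothPeriodicC)
    (hg : g ∈ SmoothPeriodicC) : f - g ∈ SmoothPeriodicC :=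
  ⟨hf.1.sub hg.1, hf.2.sub hg.2⟩

theorem smul_mem_smoothPeriodicC (c : ℂ) {f : ℝ → ℂ} (hf : f ∈ SmoothPeriodicC) :
    c • f ∈ SmoothPeriodicC :=
  ⟨contDiff_const.smul hf.1, hf.2.smul c⟩

/-- A smooth periodic function with `w - w'' = c (1 + n²) e_n` equals `c e_n`. -/
theorem eq_smul_expC_of_sub_deriv_deriv {w : ℝ → ℂ} (hw : w ∈ SmoothPeriodicC) (n : ℤ) (c : ℂ)
    (hL : ∀ x, w x - deriv (deriv w) x = c * (1 + (n : ℂ) ^ 2) * expC n x) :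
    w = c • expC n := by
  refine sub_eq_zero.mp (eq_zero_of_sub_deriv_deriv_eq_zero
    (sub_mem_smoothPeriodicC hw (smul_mem_smoothPeriodicC c (expC_mem_smoothPeriodicC n)))
    fun x => ?_)
  have hd : deriv (w - c • expC n) = fun y => deriv w y - c * (Complex.I * n * expC n y) :=
    funext fun y => ((hw.1.differentiable (by simp) y).hasDerivAt.sub
      ((hasDerivAt_expC n y).const_smul c)).deriv
  have hs' : ContDiff ℝ (⊤ : ℕ∞) (deriv w) := (contDiff_infty_iff_deriv.mp hw.1).2
  have hdd : deriv (deriv (w - c • expC n)) x =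
      deriv (deriv w) x - c * (Complex.I * n * (Complex.I * n * expC n x)) := by
    rw [hd]
    exact ((hs'.differentiable (by simp) x).hasDerivAt.sub
      (((hasDerivAt_expC n x).const_mul _).const_mul c)).deriv
  rw [hdd]
  simp only [Pi.sub_apply, Pi.smul_apply, smul_eq_mul]
  linear_combination hL x + c * (n : ℂ) ^ 2 * expC n x * Complex.I_sq

/-- Part (b) of the proof of the main theorem: if `A` is the Fourier multiplier with
`A e_0 = e_0` and `A e_n = (2(1+n²)/b) e_n` for `n ≠ 0`, and the `b`-equation is the
Euler equation for `A`, then `b = 2`. -/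
theorem fourier_multiplier_case (b : ℝ) (hb : b ≠ 0) (A : (ℝ → ℂ) → (ℝ → ℂ))
    (hlin : IsLinearMap ℂ A)
    (hzero : A (expC 0) = expC 0)
    (hmult : ∀ n : ℤ, n ≠ 0 →
      A (expC n) = fun x => ((2 * (1 + (n : ℝ) ^ 2) / b : ℝ) : ℂ) * expC n x)
    (hmaps : ∀ f ∈ SmoothPeriodicC, A f ∈ SmoothPeriodicC)
    (heuler : ∀ u ∈ SmoothPeriodicC, ∃ w ∈ SmoothPeriodicC,
      (∀ x, A w x = 2 * A u x * deriv u x + u x * deriv (A u) x) ∧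
      (∀ x, w x - deriv (deriv w) x =
        (b : ℂ) * (u x - deriv (deriv u) x) * deriv u x
          + u x * deriv (fun y => u y - deriv (deriv u) y) x)) :
    b = 2 := by
  obtain ⟨w, hw, hAw, hLw⟩ := heuler (expC 1) (expC_mem_smoothPeriodicC 1)
  have hmul (x : ℝ) : expC 1 x * expC 1 x = expC 2 x := by
    simp only [expC, ← Complex.exp_add]
    congr 1
    push_cast
    ring
  have hd (a : ℂ) : deriv (fun x => a * expC 1 x) = fun x => a * (Complex.I * expC 1 x) :=
    funext fun x => by simpa using ((hasDerivAt_expC 1 x).const_mul a).deriv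
  have hd1 : deriv (expC 1) = fun x => Complex.I * expC 1 x := by simpa using deriv_expC 1
  have hL1 : (fun y => expC 1 y - deriv (deriv (expC 1)) y) = fun y => 2 * expC 1 y := by
    funext y
    rw [hd1, hd]
    linear_combination -expC 1 y * Complex.I_sq
  have hw_eq : w = ((b + 1) * 2 * Complex.I / 5) • expC 2 := by
    refine eq_smul_expC_of_sub_deriv_deriv hw 2 _ fun x => ?_
    rw [hLw, hL1, hd, congrFun hL1 x, hd1, ← hmul]
    push_cast
    ring
  have hbC : (b : ℂ) ≠ 0 := Complex.ofReal_ne_zero.mpr hb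
  have h := hAw 0
  rw [hw_eq, hlin.map_smul, hmult 2 two_ne_zero, hmult 1 one_ne_zero, hd, hd1] at h
  simp only [Pi.smul_apply, smul_eq_mul] at h
  have h0 (n : ℤ) : expC n 0 = 1 := by simp [expC]
  rw [h0, h0] at h
  push_cast at h
  field_simp at h
  have hb2 : (b : ℂ) = 2 := by linear_combination h / 10
  exact_mod_cast hb2
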